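/- The complex linear span of the set of resolvent functions {x ↦ (w − x)^{-1} : w ∈ ℂ, Im w ≠ 0} is dense, with respect to the supremum norm, in the space C₀(ℝ, ℂ) of continuous functions ℝ → ℂ vanishing at infinity. -/

import Mathlib

open scoped ZeroAtInfty

/-- A self-adjoint, point-separating family of continuous functions on a compact space whose
pairwise products are limits of linear combinations of the family and the constants has, together
with the constants, dense linear span. -/
theorem ContinuousMap.topologicalClosure_span_insert_one_eq_top {𝕜 X : Type*} [RCLike 𝕜]
    [TopologicalSpace X] [CompactSpace X] {R : Set C(X, 𝕜)}
    (hstar : ∀ r ∈ R, star r ∈ R)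
    (hmul : ∀ r ∈ R, ∀ s ∈ R, r * s ∈ (Submodule.span 𝕜 (insert 1 R)).topologicalClosure)
    (hsep : ∀ x y : X, x ≠ y → ∃ r ∈ R, r x ≠ r y) :
    (Submodule.span 𝕜 (insert 1 R)).topologicalClosure = ⊤ := by
  set M := (Submodule.span 𝕜 (insert 1 R)).topologicalClosure
  have hspan : insert 1 R ⊆ (M : Set C(X, 𝕜)) :=
    Submodule.subset_span.trans (Submodule.le_topologicalClosure _)
  have hgen : ∀ r ∈ R, ∀ v ∈ M, r * v ∈ M := by
    intro r hr
    have hle : M ≤ M.comap (LinearMap.mulLeft 𝕜 r) := by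
      refine Submodule.topologicalClosure_minimal _ (Submodule.span_le.2 ?_)
        ((Submodule.isClosed_topologicalClosure _).preimage (continuous_const_mul r))
      rintro s (rfl | hs)
      · simpa using hspan (Set.mem_insert_of_mem _ hr)
      · exact hmul r hr s hs
    exact hle
  have hadj : ∀ a ∈ StarAlgebra.adjoin 𝕜 R, ∀ v ∈ M, a * v ∈ M := by
    intro a ha
    refine Algebra.adjoin_induction (p := fun a _ => ∀ v ∈ M, a * v ∈ M) ?_ ?_ ?_ ?_ ha
    · rintro r (hr | hr)
      · exact hgen r hr
      · exact hgen r (by simpa using hstar _ hr)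
    · intro c v hv
      rw [← Algebra.smul_def]
      exact M.smul_mem c hv
    · intro a b _ _ ha hb v hv
      rw [add_mul]
      exact M.add_mem (ha v hv) (hb v hv)
    · intro a b _ _ ha hb v hv
      rw [mul_assoc]
      exact ha _ (hb v hv)
  have hdense := ContinuousMap.starSubalgebra_topologicalClosure_eq_top_of_separatesPoints
    (StarAlgebra.adjoin 𝕜 R) (by
      intro x y hxy
      obtain ⟨r, hr, hne⟩ := hsep x y hxy
      exact ⟨r, ⟨r, StarAlgebra.subset_adjoin 𝕜 R hr, rfl⟩, hne⟩)
  rw [eq_top_iff]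
  intro f _
  have hf : f ∈ closure (StarAlgebra.adjoin 𝕜 R : Set C(X, 𝕜)) := by
    rw [← StarSubalgebra.topologicalClosure_coe, hdense]
    trivial
  refine closure_minimal ?_ (Submodule.isClosed_topologicalClosure _) hf
  intro a ha
  rw [SetLike.mem_coe, ← mul_one a]
  exact hadj a ha 1 (hspan (Set.mem_insert _ _))

/-- A function vanishing at infinity extends by zero to the one-point compactification. -/
theorem ZeroAtInftyContinuousMap.exists_onePoint_extension {X E : Type*} [TopologicalSpace X]
    [R1Space X] [TopologicalSpace E] [Zero E] (f : C₀(X, E)) :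
    ∃ g : C(OnePoint X, E), g OnePoint.infty = 0 ∧ ∀ x : X, g x = f x :=
  ⟨OnePoint.continuousMapMk f.toContinuousMap 0
    (by simpa [Filter.coclosedCompact_eq_cocompact] using f.zero_at_infty'), rfl, fun _ => rfl⟩

theorem sub_ofReal_ne_zero {w : ℂ} (hw : w.im ≠ 0) (x : ℝ) : w - (x : ℂ) ≠ 0 := by
  intro h
  apply hw
  simpa using congrArg Complex.im h

theorem norm_inv_sub_ofReal_le {w : ℂ} (hw : w.im ≠ 0) (x : ℝ) :
    ‖(w - (x : ℂ))⁻¹‖ ≤ |w.im|⁻¹ := by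
  rw [norm_inv]
  refine inv_anti₀ (abs_pos.2 hw) ?_
  simpa using Complex.abs_im_le_norm (w - (x : ℂ))

/-- The resolvent functions, extended by zero to the one-point compactification of `ℝ`. -/
def onePointResolvents : Set C(OnePoint ℝ, ℂ) :=
  {r | ∃ w : ℂ, w.im ≠ 0 ∧ r OnePoint.infty = 0 ∧ ∀ x : ℝ, r x = (w - (x : ℂ))⁻¹}

theorem exists_onePointResolvent {w : ℂ} (hw : w.im ≠ 0) :
    ∃ r ∈ onePointResolvents, r OnePoint.infty = 0 ∧ ∀ x : ℝ, r x = (w - (x : ℂ))⁻¹ := by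
  have hc : Continuous fun x : ℝ => (w - (x : ℂ))⁻¹ :=
    (by fun_prop : Continuous fun x : ℝ => w - (x : ℂ)).inv₀ (sub_ofReal_ne_zero hw)
  have ht : Filter.Tendsto (fun x : ℝ => (w - (x : ℂ))⁻¹) (Filter.cocompact ℝ) (nhds 0) := by
    refine Filter.tendsto_inv₀_cobounded.comp ?_
    rw [← Metric.cobounded_eq_cocompact, ← tendsto_norm_atTop_iff_cobounded]
    refine Filter.tendsto_atTop_mono (f := fun x : ℝ => ‖x‖ - ‖w‖) (fun x => ?_)
      (Filter.tendsto_atTop_add_const_right _ _ tendsto_norm_cobounded_atTop)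
    rw [norm_sub_rev, ← Complex.norm_real x]
    exact norm_sub_norm_le _ _
  obtain ⟨r, hr⟩ := ZeroAtInftyContinuousMap.exists_onePoint_extension (⟨⟨_, hc⟩, ht⟩ : C₀(ℝ, ℂ))
  exact ⟨r, ⟨w, hw, hr⟩, hr⟩

theorem star_mem_onePointResolvents {r : C(OnePoint ℝ, ℂ)} (hr : r ∈ onePointResolvents) :
    star r ∈ onePointResolvents := by
  obtain ⟨w, hw, h0, hx⟩ := hr
  exact ⟨star w, by simpa using hw, by simp [h0], fun x => by simp [hx]⟩

theorem exists_onePointResolvent_apply_ne {x y : OnePoint ℝ} (hxy : x ≠ y) :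
    ∃ r ∈ onePointResolvents, r x ≠ r y := by
  obtain ⟨r, hr, h0, hx⟩ := exists_onePointResolvent (w := Complex.I) (by simp)
  have hI : Complex.I.im ≠ 0 := by simp
  refine ⟨r, hr, ?_⟩
  induction x using OnePoint.rec with
  | infty =>
    induction y using OnePoint.rec with
    | infty => exact absurd rfl hxy
    | coe y => rw [h0, hx]; exact (inv_ne_zero (sub_ofReal_ne_zero hI y)).symm
  | coe x =>
    induction y using OnePoint.rec with
    | infty => rw [h0, hx]; exact inv_ne_zero (sub_ofReal_ne_zero hI x)
    | coe y =>
      rw [hx, hx]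
      intro h
      apply hxy
      simpa using h

/-- The resolvent identity expresses a product of resolvents at distinct points as a linear
combination. -/
theorem mul_mem_span_onePointResolvents {r s : C(OnePoint ℝ, ℂ)} {w z : ℂ} (hw : w.im ≠ 0)
    (hz : z.im ≠ 0) (hwz : w ≠ z)
    (hr : r OnePoint.infty = 0 ∧ ∀ x : ℝ, r x = (w - (x : ℂ))⁻¹)
    (hs : s OnePoint.infty = 0 ∧ ∀ x : ℝ, s x = (z - (x : ℂ))⁻¹) :
    r * s ∈ Submodule.span ℂ onePointResolvents := by
  have h : r * s = (z - w)⁻¹ • (r - s) := by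
    ext x
    induction x using OnePoint.rec with
    | infty => simp [hr.1, hs.1]
    | coe x =>
      have h1 := sub_ofReal_ne_zero hw x
      have h2 := sub_ofReal_ne_zero hz x
      have h3 := sub_ne_zero.2 hwz.symm
      simp only [ContinuousMap.mul_apply, ContinuousMap.smul_apply, ContinuousMap.sub_apply,
        hr.2, hs.2, smul_eq_mul]
      field_simp
      ring
  rw [h]
  exact Submodule.smul_mem _ _ (Submodule.sub_mem _ (Submodule.subset_span ⟨w, hw, hr⟩)
    (Submodule.subset_span ⟨z, hz, hs⟩))

theorem mul_self_mem_closure_span_onePointResolvents {r : C(OnePoint ℝ, ℂ)}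
    (hr : r ∈ onePointResolvents) :
    r * r ∈ (Submodule.span ℂ onePointResolvents).topologicalClosure := by
  obtain ⟨w, hw, hr⟩ := hr
  rw [← SetLike.mem_coe, Submodule.topologicalClosure_coe, Metric.mem_closure_iff]
  intro ε hε
  have hb : 0 < |w.im| := abs_pos.2 hw
  set t : ℝ := ε * |w.im| ^ 2 / 2 with ht
  have ht0 : 0 < t := by positivity
  set z : ℂ := w + (t * w.im : ℝ) * Complex.I with hz
  have hzim : z.im = (1 + t) * w.im := by simp [hz]; ring
  have hz0 : z.im ≠ 0 := by rw [hzim]; positivity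
  have hdist : ‖z - w‖ = t * |w.im| := by
    simp [hz, abs_of_pos ht0]
  have hzw : w ≠ z := by
    intro h
    rw [← h, sub_self, norm_zero] at hdist
    exact (by positivity : t * |w.im| ≠ 0) hdist.symm
  have hle : |w.im| ≤ |z.im| := by
    rw [hzim, abs_mul, abs_of_pos (by positivity : 0 < 1 + t)]
    nlinarith
  obtain ⟨s, -, hs⟩ := exists_onePointResolvent hz0
  refine ⟨r * s, mul_mem_span_onePointResolvents hw hz0 hzw hr hs, ?_⟩
  rw [ContinuousMap.dist_lt_iff hε]
  intro x
  induction x using OnePoint.rec with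
  | infty => simpa [hr.1] using hε
  | coe x =>
    have h1 := sub_ofReal_ne_zero hw x
    have h2 := sub_ofReal_ne_zero hz0 x
    have heq : (w - (x : ℂ))⁻¹ * (w - (x : ℂ))⁻¹ - (w - (x : ℂ))⁻¹ * (z - (x : ℂ))⁻¹ =
        (z - w) * ((w - (x : ℂ))⁻¹ * (w - (x : ℂ))⁻¹ * (z - (x : ℂ))⁻¹) := by
      field_simp
      ring
    rw [dist_eq_norm, ContinuousMap.mul_apply, ContinuousMap.mul_apply, hr.2, hs.2, heq,
      norm_mul, norm_mul, norm_mul, hdist]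
    have hrw := norm_inv_sub_ofReal_le hw x
    have hrz := (norm_inv_sub_ofReal_le hz0 x).trans (inv_anti₀ hb hle)
    calc t * |w.im| * (‖(w - (x : ℂ))⁻¹‖ * ‖(w - (x : ℂ))⁻¹‖ * ‖(z - (x : ℂ))⁻¹‖)
        ≤ t * |w.im| * (|w.im|⁻¹ * |w.im|⁻¹ * |w.im|⁻¹) := by gcongr
      _ = ε / 2 := by rw [ht]; field_simp
      _ < ε := half_lt_self hε

theorem mul_mem_closure_span_onePointResolvents {r s : C(OnePoint ℝ, ℂ)}
    (hr : r ∈ onePointResolvents) (hs : s ∈ onePointResolvents) :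
    r * s ∈ (Submodule.span ℂ onePointResolvents).topologicalClosure := by
  obtain ⟨w, hw, hrw⟩ := id hr
  obtain ⟨z, hz, hsz⟩ := hs
  by_cases hwz : w = z
  · subst hwz
    have hrs : s = r := by
      ext x
      induction x using OnePoint.rec with
      | infty => rw [hrw.1, hsz.1]
      | coe x => rw [hrw.2, hsz.2]
    rw [hrs]
    exact mul_self_mem_closure_span_onePointResolvents hr
  · exact Submodule.le_topologicalClosure _ (mul_mem_span_onePointResolvents hw hz hwz hrw hsz)

theorem topologicalClosure_span_insert_one_onePointResolvents :
    (Submodule.span ℂ (insert 1 onePointResolvents)).topologicalClosure = ⊤ :=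
  ContinuousMap.topologicalClosure_span_insert_one_eq_top
    (fun _ => star_mem_onePointResolvents)
    (fun _ hr _ hs => Submodule.topologicalClosure_mono
      (Submodule.span_mono (Set.subset_insert _ _)) (mul_mem_closure_span_onePointResolvents hr hs))
    (fun _ _ => exists_onePointResolvent_apply_ne)

theorem apply_infty_and_restrict_mem_of_mem_span_onePointResolvents {s : C(OnePoint ℝ, ℂ)}
    (hs : s ∈ Submodule.span ℂ onePointResolvents) :
    s OnePoint.infty = 0 ∧ (fun x : ℝ => s x) ∈ Submodule.span ℂ
      {f : ℝ → ℂ | ∃ w : ℂ, w.im ≠ 0 ∧ f = fun x : ℝ => (w - (x : ℂ))⁻¹} := by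
  induction hs using Submodule.span_induction with
  | mem r hr =>
    obtain ⟨w, hw, h0, hx⟩ := hr
    exact ⟨h0, Submodule.subset_span ⟨w, hw, funext hx⟩⟩
  | zero => exact ⟨rfl, Submodule.zero_mem _⟩
  | add a b _ _ ha hb => exact ⟨by simp [ha.1, hb.1], Submodule.add_mem _ ha.2 hb.2⟩
  | smul c a _ ha => exact ⟨by simp [ha.1], Submodule.smul_mem _ c ha.2⟩

/-- The complex linear span of the resolvent functions
x ↦ (w − x)^{-1}, w ∈ ℂ \ ℝ, is dense in C₀(ℝ, ℂ) with respect to the supremum norm. -/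
theorem span_resolvents_dense_in_C0 :
    ∀ f : C₀(ℝ, ℂ), ∀ ε : ℝ, 0 < ε →
      ∃ g ∈ Submodule.span ℂ
          {f : ℝ → ℂ | ∃ w : ℂ, w.im ≠ 0 ∧ f = fun x : ℝ => (w - (x : ℂ))⁻¹},
        ∀ x : ℝ, ‖f x - g x‖ < ε := by
  intro f ε hε
  obtain ⟨F, hF0, hF⟩ := f.exists_onePoint_extension
  have hmem : F ∈ (Submodule.span ℂ (insert 1 onePointResolvents)).topologicalClosure := by
    rw [topologicalClosure_span_insert_one_onePointResolvents]
    trivial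
  rw [← SetLike.mem_coe, Submodule.topologicalClosure_coe, Metric.mem_closure_iff] at hmem
  obtain ⟨G, hG, hFG⟩ := hmem (ε / 2) (half_pos hε)
  obtain ⟨c, s, hs, rfl⟩ := Submodule.mem_span_insert.1 hG
  obtain ⟨hs0, hsR⟩ := apply_infty_and_restrict_mem_of_mem_span_onePointResolvents hs
  rw [ContinuousMap.dist_lt_iff (half_pos hε)] at hFG
  have hc : ‖c‖ < ε / 2 := by
    simpa [hF0, hs0] using hFG OnePoint.infty
  refine ⟨_, hsR, fun x => ?_⟩
  have hx : ‖f x - (c + s x)‖ < ε / 2 := by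
    simpa [dist_eq_norm, hF] using hFG x
  calc ‖f x - s x‖ = ‖(f x - (c + s x)) + c‖ := by congr 1; ring
    _ ≤ ‖f x - (c + s x)‖ + ‖c‖ := norm_add_le _ _
    _ < ε := by linarith
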